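/- Let -π < θ_m < θ_M < π with θ_M - θ_m ∈ (0, π), let W be the open sector with these angles, let s > 0, θ_d ∈ ℝ, ρ := s((cos θ_d, sin θ_d) + i(-sin θ_d, cos θ_d)), û₁(x) := exp(ρ₁x₁ + ρ₂x₂), and assume δ_W > 0 satisfies cos(θ - θ_d) ≤ -δ_W for all θ ∈ [θ_m, θ_M]. Then û₁ is Lebesgue integrable on W and ∫_W û₁(x) dx = (i/2) e^{2iθ_d} (e^{-2iθ_M} - e^{-2iθ_m}) s^{-2}. -/

import Mathlib

open MeasureTheory

/-- The open planar sector of points `x ≠ 0` with `θm < arg (x₁ + i x₂) < θM`. -/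
def sectorW (θm θM : ℝ) : Set (ℝ × ℝ) :=
  {x : ℝ × ℝ | x ≠ 0 ∧ θm < Complex.arg (x.1 + x.2 * Complex.I) ∧
    Complex.arg (x.1 + x.2 * Complex.I) < θM}

/-- First component of `ρ := s(d + i d⊥)`. -/
noncomputable def rho1 (s θd : ℝ) : ℂ :=
  (s : ℂ) * ((Real.cos θd : ℂ) - (Real.sin θd : ℂ) * Complex.I)

/-- Second component of `ρ := s(d + i d⊥)`. -/
noncomputable def rho2 (s θd : ℝ) : ℂ :=
  (s : ℂ) * ((Real.sin θd : ℂ) + (Real.cos θd : ℂ) * Complex.I)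

/-- The CGO scalar function `û₁(x) = exp(ρ₁ x₁ + ρ₂ x₂)`. -/
noncomputable def cgoU1 (s θd : ℝ) (x : ℝ × ℝ) : ℂ :=
  Complex.exp (rho1 s θd * (x.1 : ℂ) + rho2 s θd * (x.2 : ℂ))

/-- In polar coordinates the phase `ρ·x` is `s r e^{i(θ - θd)}`. -/
lemma cgoU1_polarCoord_symm (s θd : ℝ) (p : ℝ × ℝ) :
    cgoU1 s θd (polarCoord.symm p) =
      Complex.exp (s * Complex.exp ((p.2 - θd : ℝ) * Complex.I) * p.1) := by
  rw [Complex.exp_mul_I, ← Complex.ofReal_cos, ← Complex.ofReal_sin, Real.cos_sub, Real.sin_sub]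
  simp only [cgoU1, rho1, rho2, polarCoord_symm_apply]
  push_cast
  ring_nf

lemma sectorW_eq_image_polarCoord_symm {θm θM : ℝ} (h1 : -Real.pi < θm) (h3 : θM < Real.pi) :
    sectorW θm θM = polarCoord.symm '' (Set.Ioi 0 ×ˢ Set.Ioo θm θM) := by
  ext x
  constructor
  · rintro ⟨hx, hm, hM⟩
    have hz : (x.1 + x.2 * Complex.I : ℂ) ≠ 0 := by
      intro h
      apply hx
      have hre := congrArg Complex.re h
      have him := congrArg Complex.im h
      simp at hre him
      exact Prod.ext hre him
    refine ⟨(‖(x.1 + x.2 * Complex.I : ℂ)‖, Complex.arg (x.1 + x.2 * Complex.I)),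
      ⟨norm_pos_iff.mpr hz, hm, hM⟩, ?_⟩
    ext
    · simp [polarCoord_symm_apply, Complex.norm_mul_cos_arg]
    · simp [polarCoord_symm_apply, Complex.norm_mul_sin_arg]
  · rintro ⟨⟨r, θ⟩, ⟨hr, hm, hM⟩, rfl⟩
    simp only [Set.mem_Ioi] at hr hm hM
    have harg : Complex.arg ((r * Real.cos θ : ℝ) + (r * Real.sin θ : ℝ) * Complex.I) = θ := by
      have := Complex.arg_mul_cos_add_sin_mul_I hr (θ := θ) ⟨by linarith, by linarith⟩
      rw [← this]
      congr 1
      push_cast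
      rw [this]
      ring
    refine ⟨?_, ?_, ?_⟩
    · intro h
      have hc : r * Real.cos θ = 0 := congrArg Prod.fst h
      have hs : r * Real.sin θ = 0 := congrArg Prod.snd h
      have := Real.sin_sq_add_cos_sq θ
      rcases mul_eq_zero.mp hc with h0 | h0
      · exact hr.ne' h0
      · rcases mul_eq_zero.mp hs with h0' | h0'
        · exact hr.ne' h0'
        · simp [h0, h0'] at this
    · simpa only [polarCoord_symm_apply, harg] using hm
    · simpa only [polarCoord_symm_apply, harg] using hM

lemma integrableOn_mul_exp_Ioi {b : ℝ} (hb : 0 < b) :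
    IntegrableOn (fun r : ℝ => r * Real.exp (-b * r)) (Set.Ioi 0) := by
  simpa using integrableOn_rpow_mul_exp_neg_mul_rpow (p := 1) (s := 1) (by norm_num) zero_lt_one hb

lemma integrableOn_mul_cexp_Ioi {w : ℂ} (hw : w.re < 0) :
    IntegrableOn (fun r : ℝ => (r : ℂ) * Complex.exp (w * r)) (Set.Ioi 0) := by
  refine Integrable.mono' (integrableOn_mul_exp_Ioi (neg_pos.mpr hw))
    (by fun_prop : Continuous _).aestronglyMeasurable
    ((ae_restrict_iff' measurableSet_Ioi).mpr (Filter.Eventually.of_forall fun r hr => ?_))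
  rw [norm_mul, Complex.norm_exp, Complex.re_mul_ofReal, Complex.norm_real,
    Real.norm_of_nonneg (Set.mem_Ioi.mp hr).le, neg_neg]

lemma integral_mul_cexp_Ioi {w : ℂ} (hw : w.re < 0) :
    ∫ r in Set.Ioi (0 : ℝ), (r : ℂ) * Complex.exp (w * r) = (w ^ 2)⁻¹ := by
  have hw0 : w ≠ 0 := by
    rintro rfl
    simp at hw
  have hderiv : ∀ r ∈ Set.Ici (0 : ℝ),
      HasDerivAt (fun r : ℝ => w⁻¹ * (r * Complex.exp (w * r)) - (w ^ 2)⁻¹ * Complex.exp (w * r))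
        ((r : ℂ) * Complex.exp (w * r)) r := by
    intro r _
    have hid : HasDerivAt (fun r : ℝ => (r : ℂ)) 1 r := Complex.ofRealCLM.hasDerivAt
    have hexp := (hid.const_mul w).cexp
    convert! ((hid.mul hexp).const_mul w⁻¹).sub (hexp.const_mul (w ^ 2)⁻¹) using 1
    field_simp
    ring
  have hlim : ∀ n : ℕ, Filter.Tendsto (fun r : ℝ => (r : ℂ) ^ n * Complex.exp (w * r))
      Filter.atTop (nhds 0) := by
    intro n
    rw [tendsto_zero_iff_norm_tendsto_zero]
    refine (tendsto_rpow_mul_exp_neg_mul_atTop_nhds_zero n (-w.re) (neg_pos.mpr hw)).congr' ?_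
    filter_upwards [Filter.eventually_ge_atTop 0] with r hr
    rw [norm_mul, norm_pow, Complex.norm_exp, Complex.re_mul_ofReal, Complex.norm_real,
      Real.norm_of_nonneg hr, neg_neg, Real.rpow_natCast]
  have htendsto := ((hlim 1).const_mul w⁻¹).sub ((hlim 0).const_mul (w ^ 2)⁻¹)
  simp only [pow_one, pow_zero, one_mul, mul_zero, sub_zero] at htendsto
  rw [integral_Ioi_of_hasDerivAt_of_tendsto' hderiv (integrableOn_mul_cexp_Ioi hw) htendsto]
  simp

lemma re_ofReal_mul_exp_mul_I (s φ : ℝ) :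
    ((s : ℂ) * Complex.exp (φ * Complex.I)).re = s * Real.cos φ := by
  rw [Complex.re_ofReal_mul, Complex.exp_ofReal_mul_I_re]

lemma integrableOn_polar_cgoU1 {θm θM s θd δW : ℝ} (hs : 0 < s) (hδ : 0 < δW)
    (hcos : ∀ θ ∈ Set.Icc θm θM, Real.cos (θ - θd) ≤ -δW) :
    IntegrableOn (fun p : ℝ × ℝ => p.1 • cgoU1 s θd (polarCoord.symm p))
      (Set.Ioi 0 ×ˢ Set.Ioo θm θM) := by
  have hmeas : MeasurableSet (Set.Ioi (0 : ℝ) ×ˢ Set.Ioo θm θM) :=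
    measurableSet_Ioi.prod measurableSet_Ioo
  have hbound : IntegrableOn (fun p : ℝ × ℝ => p.1 * Real.exp (-(s * δW) * p.1) * 1)
      (Set.Ioi 0 ×ˢ Set.Ioo θm θM) := by
    rw [IntegrableOn, Measure.volume_eq_prod, ← Measure.prod_restrict]
    exact (integrableOn_mul_exp_Ioi (mul_pos hs hδ)).mul_prod (integrable_const (1 : ℝ))
  refine Integrable.mono' hbound ?_ ?_
  · simp only [cgoU1_polarCoord_symm]
    exact (by fun_prop : Continuous _).aestronglyMeasurable
  · refine (ae_restrict_iff' hmeas).mpr (Filter.Eventually.of_forall ?_)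
    rintro ⟨r, θ⟩ ⟨hr, hθ⟩
    simp only [Set.mem_Ioi] at hr hθ
    rw [cgoU1_polarCoord_symm, norm_smul, Complex.norm_exp, Complex.re_mul_ofReal,
      re_ofReal_mul_exp_mul_I, mul_one, Real.norm_of_nonneg hr.le]
    have := hcos θ (Set.Ioo_subset_Icc_self hθ)
    gcongr
    nlinarith

lemma integral_polar_cgoU1 {θm θM s θd δW : ℝ} (h2 : θm < θM) (hs : 0 < s) (hδ : 0 < δW)
    (hcos : ∀ θ ∈ Set.Icc θm θM, Real.cos (θ - θd) ≤ -δW) :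
    ∫ p in Set.Ioi 0 ×ˢ Set.Ioo θm θM, p.1 • cgoU1 s θd (polarCoord.symm p)
      = (Complex.I / 2) * Complex.exp (2 * Complex.I * (θd : ℂ))
          * (Complex.exp (-2 * Complex.I * (θM : ℂ))
              - Complex.exp (-2 * Complex.I * (θm : ℂ)))
          * ((s : ℂ) ^ 2)⁻¹ := by
  have hint := integrableOn_polar_cgoU1 hs hδ hcos
  rw [IntegrableOn, Measure.volume_eq_prod, ← Measure.prod_restrict] at hint
  rw [Measure.volume_eq_prod, ← Measure.prod_restrict, integral_prod_symm _ hint]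
  have hradial : ∀ θ ∈ Set.Ioo θm θM,
      ∫ r in Set.Ioi (0 : ℝ), r • cgoU1 s θd (polarCoord.symm (r, θ)) =
        Complex.exp (2 * Complex.I * θd) * ((s : ℂ) ^ 2)⁻¹ *
          Complex.exp (-2 * Complex.I * θ) := by
    intro θ hθ
    have hre : ((s : ℂ) * Complex.exp ((θ - θd : ℝ) * Complex.I)).re < 0 := by
      rw [re_ofReal_mul_exp_mul_I]
      have := hcos θ (Set.Ioo_subset_Icc_self hθ)
      exact mul_neg_of_pos_of_neg hs (by linarith)
    simp only [cgoU1_polarCoord_symm, Complex.real_smul]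
    rw [integral_mul_cexp_Ioi hre, mul_pow, mul_inv, ← Complex.exp_nat_mul, ← Complex.exp_neg,
      mul_right_comm, ← Complex.exp_add, mul_comm]
    congr 2
    push_cast
    ring
  rw [setIntegral_congr_fun measurableSet_Ioo hradial, ← integral_Ioc_eq_integral_Ioo,
    ← intervalIntegral.integral_of_le h2.le, intervalIntegral.integral_const_mul,
    integral_exp_mul_complex (by simp)]
  have hI : (Complex.I / 2 : ℂ) = (-2 * Complex.I)⁻¹ := by
    rw [mul_inv, Complex.inv_I]
    ring
  rw [hI]
  ring

/-- `û₁` is Lebesgue integrable on the sector `W` and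
`∫_W û₁ = (i/2) e^{2iθd} (e^{-2iθM} - e^{-2iθm}) s^{-2}`. -/
theorem stmt_4 (θm θM s θd δW : ℝ)
    (h1 : -Real.pi < θm) (h2 : θm < θM) (h3 : θM < Real.pi)
    (h4 : θM - θm < Real.pi)
    (hs : 0 < s) (hδ : 0 < δW)
    (hcos : ∀ θ ∈ Set.Icc θm θM, Real.cos (θ - θd) ≤ -δW) :
    IntegrableOn (cgoU1 s θd) (sectorW θm θM) volume ∧
    ∫ x in sectorW θm θM, cgoU1 s θd x
      = (Complex.I / 2) * Complex.exp (2 * Complex.I * (θd : ℂ))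
          * (Complex.exp (-2 * Complex.I * (θM : ℂ))
              - Complex.exp (-2 * Complex.I * (θm : ℂ)))
          * ((s : ℂ) ^ 2)⁻¹ := by
  have hmeas : MeasurableSet (Set.Ioi (0 : ℝ) ×ˢ Set.Ioo θm θM) :=
    measurableSet_Ioi.prod measurableSet_Ioo
  have hinj : Set.InjOn polarCoord.symm (Set.Ioi (0 : ℝ) ×ˢ Set.Ioo θm θM) := by
    refine polarCoord.symm.injOn.mono ?_
    exact Set.prod_mono subset_rfl (Set.Ioo_subset_Ioo h1.le h3.le)
  have hderiv : ∀ p ∈ Set.Ioi (0 : ℝ) ×ˢ Set.Ioo θm θM,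
      HasFDerivWithinAt polarCoord.symm (fderivPolarCoordSymm p)
        (Set.Ioi (0 : ℝ) ×ˢ Set.Ioo θm θM) p :=
    fun p _ => (hasFDerivAt_polarCoord_symm p).hasFDerivWithinAt
  have hcongr : Set.EqOn
      (fun p : ℝ × ℝ => |(fderivPolarCoordSymm p).det| • cgoU1 s θd (polarCoord.symm p))
      (fun p => p.1 • cgoU1 s θd (polarCoord.symm p)) (Set.Ioi (0 : ℝ) ×ˢ Set.Ioo θm θM) := by
    intro p hp
    simp only [det_fderivPolarCoordSymm, abs_of_pos (Set.mem_Ioi.mp hp.1)]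
  rw [sectorW_eq_image_polarCoord_symm h1 h3]
  constructor
  · rw [integrableOn_image_iff_integrableOn_abs_det_fderiv_smul volume hmeas hderiv hinj,
      integrableOn_congr_fun hcongr hmeas]
    exact integrableOn_polar_cgoU1 hs hδ hcos
  · rw [integral_image_eq_integral_abs_det_fderiv_smul volume hmeas hderiv hinj,
      setIntegral_congr_fun hmeas hcongr]
    exact integral_polar_cgoU1 h2 hs hδ hcos
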